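/- Suppose U(x) = (x−1)^4 V(x) is a monic real polynomial of degree 8, where V is a monic real polynomial of degree 4 with no real roots, and U defines the sign pattern (+,−,−,+,−,+,+,+,+). Then there exist a real number t > 0 and real numbers S > 0, M, N with N ≥ M^2/4 such that U(x) + t x (x−1)^4 = (x−1)^4 (x^2 + Sx + S^2/4)(x^2 + Mx + N) and the polynomial U(x) + t x (x−1)^4 defines one of the three sign patterns (+,−,−,+,−,+,−,+,+), (+,−,−,+,−,+,+,+,+), or (+,−,−,+,−,+,0,+,+) (where the entry 0 means that the coefficient of x^2 is equal to zero). -/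

import Mathlib

open Polynomial

/-- A degree-8 real polynomial `P` defines the sign pattern `σ = (σ_0, …, σ_8)`
(with entries `1` for `+`, `-1` for `−`, `0` meaning the corresponding
coefficient vanishes) if for each `j` the sign of the coefficient of
`x^(8-j)` is `σ_j`. -/
def definesSignPattern (P : Polynomial ℝ) (σ : Fin 9 → ℝ) : Prop :=
  ∀ j : Fin 9, Real.sign (P.coeff (8 - (j : ℕ))) = σ j

theorem Real.sign_eq_one_iff {r : ℝ} : Real.sign r = 1 ↔ 0 < r := by
  refine ⟨fun h => ?_, Real.sign_of_pos⟩
  rcases lt_trichotomy r 0 with hr | rfl | hr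
  · rw [Real.sign_of_neg hr] at h; norm_num at h
  · simp at h
  · exact hr

theorem Real.sign_eq_neg_one_iff {r : ℝ} : Real.sign r = -1 ↔ r < 0 := by
  rw [← neg_pos, ← Real.sign_eq_one_iff, Real.sign_neg, neg_eq_iff_eq_neg]

/-- The quotient `v(-x) / x`, for `v` a monic quartic with positive constant term, attains its
minimum on the positive half-line. -/
theorem exists_min_quartic_neg_div (a b c d : ℝ) (hd : 0 < d) :
    ∃ s > 0, ∀ x > 0,
      s ^ 3 - a * s ^ 2 + b * s - c + d / s ≤ x ^ 3 - a * x ^ 2 + b * x - c + d / x := by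
  set A := |a| + |b| + |c| with hA
  have ha := abs_le.mp (le_refl |a|)
  have hb := abs_le.mp (le_refl |b|)
  have hc := abs_le.mp (le_refl |c|)
  have ha0 := abs_nonneg a
  have hb0 := abs_nonneg b
  have hc0 := abs_nonneg c
  have hA0 : 0 ≤ A := by positivity
  set R := 1 + 2 * A + d with hR
  have hR1 : 1 < R := by linarith
  have hR0 : 0 < R := by linarith
  have hdR : d / R < 1 := by rw [div_lt_one hR0]; linarith
  have hdR0 : 0 < d / R := by positivity
  obtain ⟨s, hs, hmin⟩ := isCompact_Icc.exists_isMinOn (s := Set.Icc (d / R) R)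
    (f := fun x : ℝ => x ^ 3 - a * x ^ 2 + b * x - c + d / x)
    ⟨1, hdR.le, hR1.le⟩ (by
      refine ContinuousOn.add (by fun_prop) (continuousOn_const.div continuousOn_id ?_)
      intro x hx
      exact (hdR0.trans_le hx.1).ne')
  have h1 := hmin (show (1 : ℝ) ∈ Set.Icc (d / R) R from ⟨hdR.le, hR1.le⟩)
  simp only [Set.mem_ofPred_eq] at h1
  refine ⟨s, hdR0.trans_le hs.1, fun x hx => ?_⟩
  rcases lt_or_ge x (d / R) with hlt | hge
  · refine h1.trans ?_
    have hdx : R ≤ d / x := by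
      rw [le_div_iff₀ hx]
      rw [lt_div_iff₀ hR0] at hlt
      linarith
    have hx1 : x ≤ 1 := by linarith
    have hx2 : x ^ 2 ≤ 1 := by nlinarith
    have e1 : -|a| ≤ -a * x ^ 2 := by nlinarith [sq_nonneg x]
    have e2 : -|b| ≤ b * x := by nlinarith
    have e3 : 0 < x ^ 3 := by positivity
    linarith
  · rcases le_or_gt x R with hle | hgt
    · exact hmin (show x ∈ Set.Icc (d / R) R from ⟨hge, hle⟩)
    · refine h1.trans ?_
      have hx1 : 1 ≤ x := by linarith
      have hx2 : x ≤ x ^ 2 := by nlinarith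
      have e1 : -|a| * x ^ 2 ≤ -a * x ^ 2 := by nlinarith [sq_nonneg x]
      have e2 : -|b| * x ^ 2 ≤ b * x := by nlinarith
      have e3 : -|c| * x ^ 2 ≤ -|c| := by nlinarith
      have e4 : R - A ≤ x ^ 2 * (x - A) := by nlinarith
      have e5 : 0 < d / x := by positivity
      have e6 : x ^ 2 * (x - A) = x ^ 3 - |a| * x ^ 2 - |b| * x ^ 2 - |c| * x ^ 2 := by
        rw [hA]; ring
      linarith

/-- A quadratic whose product with `(x + s) ^ 2` is nonnegative has nonpositive discriminant. -/
theorem sq_div_four_le_of_forall_mul_nonneg {s M N : ℝ}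
    (h : ∀ x : ℝ, 0 ≤ (x + s) ^ 2 * (x ^ 2 + M * x + N)) : M ^ 2 / 4 ≤ N := by
  have hq : ∀ x ∈ ({-s}ᶜ : Set ℝ), 0 ≤ x ^ 2 + M * x + N := fun x hx =>
    nonneg_of_mul_nonneg_right (h x) (by
      have : x + s ≠ 0 := fun h0 => hx (by simpa using eq_neg_of_add_eq_zero_left h0)
      positivity)
  have hcl : IsClosed {x : ℝ | 0 ≤ x ^ 2 + M * x + N} :=
    isClosed_le continuous_const (by fun_prop)
  have := closure_minimal hq hcl ((dense_compl_singleton (-s)) (-M / 2))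
  change 0 ≤ (-M / 2) ^ 2 + M * (-M / 2) + N at this
  linarith

/-- A monic real quartic without real roots and with positive constant term acquires a negative
double root after adding a suitable positive multiple of `x`, the other two roots staying
nonreal or forming a double root. -/
theorem exists_quartic_add_linear_eq_sq_mul {a b c d : ℝ} (hd : 0 < d)
    (hroots : ∀ x : ℝ, x ^ 4 + a * x ^ 3 + b * x ^ 2 + c * x + d ≠ 0) :
    ∃ t S M N : ℝ, 0 < t ∧ 0 < S ∧ M ^ 2 / 4 ≤ N ∧ a = S + M ∧
      b = S ^ 2 / 4 + S * M + N ∧ c + t = S * N + S ^ 2 / 4 * M ∧ d = S ^ 2 / 4 * N := by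
  have hpos : ∀ x : ℝ, 0 < x ^ 4 + a * x ^ 3 + b * x ^ 2 + c * x + d := by
    intro x
    by_contra! hx
    obtain ⟨y, hy⟩ := mem_range_of_exists_le_of_exists_ge
      (f := fun x : ℝ => x ^ 4 + a * x ^ 3 + b * x ^ 2 + c * x + d) (c := 0)
      (by fun_prop) ⟨x, hx⟩ ⟨0, by simpa using hd.le⟩
    exact hroots y hy
  obtain ⟨s, hs, hmin⟩ := exists_min_quartic_neg_div a b c d hd
  set t := s ^ 3 - a * s ^ 2 + b * s - c + d / s with ht
  have hts : t * s = s ^ 4 - a * s ^ 3 + b * s ^ 2 - c * s + d := by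
    rw [ht]; field_simp
  have ht0 : 0 < t := by
    refine pos_of_mul_pos_left ?_ hs.le
    rw [hts]
    linarith [hpos (-s)]
  have hnn : ∀ x : ℝ, 0 ≤ x ^ 4 + a * x ^ 3 + b * x ^ 2 + (c + t) * x + d := by
    intro x
    rcases le_or_gt 0 x with hx | hx
    · linarith [hpos x, mul_nonneg ht0.le hx]
    · have h := mul_le_mul_of_nonneg_right (hmin (-x) (by linarith)) (neg_pos.mpr hx).le
      have e : ((-x) ^ 3 - a * (-x) ^ 2 + b * (-x) - c + d / (-x)) * (-x) =
          x ^ 4 + a * x ^ 3 + b * x ^ 2 + c * x + d := by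
        have := hx.ne
        field_simp
        ring
      rw [e] at h
      linarith
  have hderiv : -4 * s ^ 3 + 3 * a * s ^ 2 - 2 * b * s + (c + t) = 0 := by
    have hloc : IsLocalMin
        (fun x : ℝ => x ^ 4 + a * x ^ 3 + b * x ^ 2 + (c + t) * x + d) (-s) :=
      Filter.Eventually.of_forall fun x => by
        refine le_trans (le_of_eq ?_) (hnn x)
        linarith
    have hd' : HasDerivAt (fun x : ℝ => x ^ 4 + a * x ^ 3 + b * x ^ 2 + (c + t) * x + d)
        (4 * (-s) ^ 3 + a * (3 * (-s) ^ 2) + b * (2 * (-s)) + (c + t)) (-s) := by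
      have h := ((((hasDerivAt_pow 4 (-s)).fun_add ((hasDerivAt_pow 3 (-s)).const_mul a)).fun_add
        ((hasDerivAt_pow 2 (-s)).const_mul b)).fun_add
        ((hasDerivAt_id' (-s)).const_mul (c + t))).add_const d
      refine h.congr_deriv ?_
      norm_num
    linarith [hloc.hasDerivAt_eq_zero hd']
  have hcoef : c + t = 2 * s * (b - 2 * s * (a - 2 * s) - s ^ 2) + s ^ 2 * (a - 2 * s) := by
    linarith
  have hconst : d = s ^ 2 * (b - 2 * s * (a - 2 * s) - s ^ 2) := by
    linear_combination -hts + s * hderiv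
  refine ⟨t, 2 * s, a - 2 * s, b - 2 * s * (a - 2 * s) - s ^ 2, ht0, by positivity, ?_,
    by ring, by ring, by linarith, by linarith⟩
  refine sq_div_four_le_of_forall_mul_nonneg (s := s) fun x => (hnn x).trans_eq ?_
  linear_combination x * hcoef + hconst

theorem Polynomial.eq_quartic_of_monic_of_degree_eq_four {R : Type*} [CommRing R] [Nontrivial R]
    {V : R[X]} (hV : V.Monic) (hdeg : V.degree = 4) :
    V = X ^ 4 + C (V.coeff 3) * X ^ 3 + C (V.coeff 2) * X ^ 2 + C (V.coeff 1) * X +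
      C (V.coeff 0) := by
  have hn : V.natDegree = 4 := natDegree_eq_of_degree_eq_some hdeg
  conv_lhs => rw [hV.as_sum, hn]
  simp only [Finset.sum_range_succ, Finset.sum_range_zero, pow_zero, pow_one, mul_one]
  ring

/-- A polynomial defines the pattern `(+,−,−,+,−,+,τ,+,+)` exactly when
its coefficients have the corresponding signs. -/
theorem definesSignPattern_iff {P : ℝ[X]} {τ : ℝ} :
    definesSignPattern P ![1, -1, -1, 1, -1, 1, τ, 1, 1] ↔
      0 < P.coeff 8 ∧ P.coeff 7 < 0 ∧ P.coeff 6 < 0 ∧ 0 < P.coeff 5 ∧ P.coeff 4 < 0 ∧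
        0 < P.coeff 3 ∧ Real.sign (P.coeff 2) = τ ∧ 0 < P.coeff 1 ∧ 0 < P.coeff 0 := by
  simp [definesSignPattern, Fin.forall_fin_succ, Real.sign_eq_one_iff, Real.sign_eq_neg_one_iff]

/-- The coefficients of `t x (x - 1) ^ 4`. -/
theorem coeff_C_mul_X_mul_X_sub_one_pow_four (t : ℝ) (n : ℕ) :
    (C t * X * (X - 1) ^ 4).coeff n =
      if n = 5 then t else if n = 4 then -4 * t else if n = 3 then 6 * t else
        if n = 2 then -4 * t else if n = 1 then t else 0 := by
  have h : (C t * X * (X - 1) ^ 4 : ℝ[X]) = C t * X ^ 5 + C (-4 * t) * X ^ 4 +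
      C (6 * t) * X ^ 3 + C (-4 * t) * X ^ 2 + C t * X := by
    simp only [map_mul, map_neg, map_ofNat]
    ring
  rw [h]
  simp only [coeff_add, coeff_C_mul, coeff_X_pow, coeff_X, @eq_comm ℕ 1]
  split_ifs <;> first | omega | simp

/-- If `U = (x−1)⁴ V`, with `V` monic of degree 4 without real roots, defines
the sign pattern (+,−,−,+,−,+,+,+,+), then for some `t > 0` the polynomial
`U + t·x(x−1)⁴` has the form `(x−1)⁴ (x² + Sx + S²/4)(x² + Mx + N)` with
`S > 0`, `N ≥ M²/4`, and defines one of the sign patterns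
(+,−,−,+,−,+,−,+,+), (+,−,−,+,−,+,+,+,+) or (+,−,−,+,−,+,0,+,+). -/
theorem stmt14 (U V : Polynomial ℝ)
    (hVmonic : V.Monic) (hVdeg : V.degree = 4) (hVroots : ∀ x : ℝ, V.eval x ≠ 0)
    (hU : U = (X - 1) ^ 4 * V)
    (hpat : definesSignPattern U ![1, -1, -1, 1, -1, 1, 1, 1, 1]) :
    ∃ t S M N : ℝ, 0 < t ∧ 0 < S ∧ M ^ 2 / 4 ≤ N ∧
      U + C t * X * (X - 1) ^ 4 =
        (X - 1) ^ 4 * (X ^ 2 + C S * X + C (S ^ 2 / 4)) *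
          (X ^ 2 + C M * X + C N) ∧
      (definesSignPattern (U + C t * X * (X - 1) ^ 4)
          ![1, -1, -1, 1, -1, 1, -1, 1, 1] ∨
       definesSignPattern (U + C t * X * (X - 1) ^ 4)
          ![1, -1, -1, 1, -1, 1, 1, 1, 1] ∨
       definesSignPattern (U + C t * X * (X - 1) ^ 4)
          ![1, -1, -1, 1, -1, 1, 0, 1, 1]) := by
  have hV4 := eq_quartic_of_monic_of_degree_eq_four hVmonic hVdeg
  have hU' := definesSignPattern_iff.mp hpat
  have hd : 0 < V.coeff 0 := by
    have h := hU'.2.2.2.2.2.2.2.2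
    rw [hU, mul_coeff_zero, coeff_zero_eq_eval_zero] at h
    norm_num at h
    exact h
  obtain ⟨t, S, M, N, ht, hS, hMN, ha, hb, hc, hd'⟩ :=
    exists_quartic_add_linear_eq_sq_mul (a := V.coeff 3) (b := V.coeff 2) (c := V.coeff 1) hd
      fun x => by
        have h := hVroots x
        rw [hV4] at h
        simpa using h
  refine ⟨t, S, M, N, ht, hS, hMN, ?_, ?_⟩
  · rw [ha, hb, hd', eq_sub_of_add_eq hc] at hV4
    rw [hU, hV4]
    simp only [map_add, map_sub, map_mul]
    ring
  · obtain ⟨h8, h7, h6, h5, h4, h3, -, h1, h0⟩ := hU'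
    have hsigns : ∀ τ, Real.sign ((U + C t * X * (X - 1) ^ 4).coeff 2) = τ →
        definesSignPattern (U + C t * X * (X - 1) ^ 4) ![1, -1, -1, 1, -1, 1, τ, 1, 1] := by
      intro τ hτ
      refine definesSignPattern_iff.mpr ⟨?_, ?_, ?_, ?_, ?_, ?_, hτ, ?_, ?_⟩ <;>
        rw [coeff_add, coeff_C_mul_X_mul_X_sub_one_pow_four] <;> norm_num <;> linarith
    rcases lt_trichotomy ((U + C t * X * (X - 1) ^ 4).coeff 2) 0 with h | h | h
    · exact Or.inl (hsigns _ (Real.sign_of_neg h))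
    · exact Or.inr (Or.inr (hsigns _ (by rw [h, Real.sign_zero])))
    · exact Or.inr (Or.inl (hsigns _ (Real.sign_of_pos h)))
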